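/- Let F : ℝ^d → ℝ be a differentiable function that is μ-strongly convex and whose gradient is L-Lipschitz continuous (0 < μ ≤ L), and let x* be its (unique) minimizer. If 0 < η ≤ 1/L, then for every x ∈ ℝ^d, ‖x − η∇F(x) − x*‖ ≤ (1 − ημ)‖x − x*‖. -/

import Mathlib

section HilbertSpace

variable {E : Type*} [NormedAddCommGroup E] [InnerProductSpace ℝ E]

/-- Cocoercivity of the gradient `g` of a convex function that lies below its tangent
quadratics of curvature `M`. -/
theorem norm_sub_sq_le_mul_inner_of_quadratic_bounds {f : E → ℝ} {g : E → E} {M : ℝ} (hM : 0 < M)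
    (hlower : ∀ x y, f x + inner ℝ (g x) (y - x) ≤ f y)
    (hupper : ∀ x y, f y ≤ f x + inner ℝ (g x) (y - x) + M / 2 * ‖y - x‖ ^ 2) (x y : E) :
    ‖g x - g y‖ ^ 2 ≤ M * inner ℝ (g x - g y) (x - y) := by
  have key (x y : E) :
      f x + inner ℝ (g x) (y - x) + M⁻¹ / 2 * ‖g x - g y‖ ^ 2 ≤ f y := by
    have h₁ := hlower x (y + M⁻¹ • (g x - g y))
    have h₂ := hupper y (y + M⁻¹ • (g x - g y))
    rw [add_sub_cancel_left, norm_smul, inner_smul_right, mul_pow, Real.norm_eq_abs,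
      sq_abs] at h₂
    rw [add_sub_right_comm, inner_add_right, inner_smul_right] at h₁
    have h₃ : inner ℝ (g x) (g x - g y) - inner ℝ (g y) (g x - g y) = ‖g x - g y‖ ^ 2 := by
      rw [← inner_sub_left, real_inner_self_eq_norm_sq]
    have h₄ : M / 2 * (M⁻¹ ^ 2 * ‖g x - g y‖ ^ 2) = M⁻¹ / 2 * ‖g x - g y‖ ^ 2 := by
      field_simp
    linear_combination h₁ + h₂ + h₄ - M⁻¹ * h₃
  have hxy := key x y
  have hyx := key y x
  rw [norm_sub_rev (g y), ← neg_sub y x] at hyx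
  rw [← neg_sub y x]
  simp only [inner_neg_right, inner_sub_left] at *
  have h : M⁻¹ * ‖g x - g y‖ ^ 2 ≤ inner ℝ (g y) (y - x) - inner ℝ (g x) (y - x) := by
    linarith
  have := mul_le_mul_of_nonneg_left h hM.le
  rw [mul_inv_cancel_left₀ hM.ne'] at this
  linarith

variable [CompleteSpace E]

theorem HasGradientAt.hasDerivAt_comp_add_smul {f : E → ℝ} {g x v : E} {t : ℝ}
    (h : HasGradientAt f g (x + t • v)) :
    HasDerivAt (fun s : ℝ => f (x + s • v)) (inner ℝ g v) t := by
  have hline : HasDerivAt (fun s : ℝ => x + s • v) v t := by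
    simpa using ((hasDerivAt_id t).smul_const v).const_add x
  exact (h.hasFDerivAt.comp_hasDerivAt t hline).congr_deriv InnerProductSpace.toDual_apply_apply

/-- A convex function lies above its tangent hyperplanes. -/
theorem ConvexOn.add_inner_le_of_hasGradientAt {f : E → ℝ} {g x : E}
    (hf : ConvexOn ℝ Set.univ f) (h : HasGradientAt f g x) (y : E) :
    f x + inner ℝ g (y - x) ≤ f y := by
  have hline : ConvexOn ℝ Set.univ (fun t : ℝ => f (x + t • (y - x))) := by
    have := hf.comp_affineMap (AffineMap.lineMap x y)
    simpa [Function.comp_def, AffineMap.lineMap_apply, add_comm] using this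
  have hderiv : HasDerivAt (fun t : ℝ => f (x + t • (y - x))) (inner ℝ g (y - x)) 0 :=
    HasGradientAt.hasDerivAt_comp_add_smul (by simpa using h)
  have := hline.le_slope_of_hasDerivAt (Set.mem_univ 0) (Set.mem_univ 1) one_pos hderiv
  simp [slope_def_field] at this
  linarith

/-- The descent lemma: a function with `L`-Lipschitz gradient lies below the quadratic
of curvature `L` tangent to it at any point. -/
theorem le_add_inner_add_sq_of_lipschitz_gradient {f : E → ℝ} {L : ℝ}
    (hf : Differentiable ℝ f)
    (hlip : ∀ x y, ‖gradient f x - gradient f y‖ ≤ L * ‖x - y‖) (x y : E) :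
    f y ≤ f x + inner ℝ (gradient f x) (y - x) + L / 2 * ‖y - x‖ ^ 2 := by
  set v := y - x with hv
  have hderiv (t : ℝ) : HasDerivAt
      (fun t : ℝ => f (x + t • v) - t * inner ℝ (gradient f x) v - L / 2 * ‖v‖ ^ 2 * t ^ 2)
      (inner ℝ (gradient f (x + t • v) - gradient f x) v - L * ‖v‖ ^ 2 * t) t := by
    have h₁ := (hf (x + t • v)).hasGradientAt.hasDerivAt_comp_add_smul
    have h₂ := (hasDerivAt_id t).mul_const (inner ℝ (gradient f x) v)
    have h₃ := (hasDerivAt_pow 2 t).const_mul (L / 2 * ‖v‖ ^ 2)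
    refine ((h₁.sub h₂).sub h₃).congr_deriv ?_
    rw [inner_sub_left]
    push_cast
    ring
  have hanti := antitoneOn_of_deriv_nonpos (convex_Ici (0 : ℝ))
    (fun t _ => (hderiv t).continuousAt.continuousWithinAt)
    (fun t _ => (hderiv t).differentiableAt.differentiableWithinAt) (fun t ht => by
      rw [interior_Ici, Set.mem_Ioi] at ht
      rw [(hderiv t).deriv]
      have h₁ := real_inner_le_norm (gradient f (x + t • v) - gradient f x) v
      have h₂ := hlip (x + t • v) x
      rw [add_sub_cancel_left, norm_smul, Real.norm_of_nonneg ht.le] at h₂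
      nlinarith [mul_le_mul_of_nonneg_right h₂ (norm_nonneg v)])
  have := hanti (Set.mem_Ici.2 le_rfl) (Set.mem_Ici.2 zero_le_one) zero_le_one
  simp only [one_smul, zero_smul, add_zero, hv, add_sub_cancel] at this
  linarith

theorem HasGradientAt.sub_half_mul_norm_sq {f : E → ℝ} {g x : E} (h : HasGradientAt f g x)
    (μ : ℝ) : HasGradientAt (fun x => f x - μ / 2 * ‖x‖ ^ 2) (g - μ • x) x := by
  rw [hasGradientAt_iff_hasFDerivAt] at h ⊢
  refine (h.sub ((hasStrictFDerivAt_norm_sq x).hasFDerivAt.const_mul (μ / 2))).congr_fderiv ?_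
  ext v
  simp
  ring

/-- For a `μ`-strongly convex function `f` with `L`-Lipschitz gradient, the gradient of
`f - μ / 2 * ‖·‖ ^ 2` is cocoercive with constant `L - μ`. -/
theorem norm_sq_le_mul_inner_of_strongly_convex {f : E → ℝ} {μ L : ℝ} (hμ : 0 ≤ μ)
    (hμL : μ ≤ L) (hf : Differentiable ℝ f)
    (hstrong : ConvexOn ℝ Set.univ (fun x => f x - μ / 2 * ‖x‖ ^ 2))
    (hlip : ∀ x y, ‖gradient f x - gradient f y‖ ≤ L * ‖x - y‖) (x y : E) :
    0 ≤ inner ℝ (gradient f x - gradient f y - μ • (x - y)) (x - y) ∧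
    ‖gradient f x - gradient f y - μ • (x - y)‖ ^ 2 ≤
      (L - μ) * inner ℝ (gradient f x - gradient f y - μ • (x - y)) (x - y) := by
  have hlower (x y : E) := hstrong.add_inner_le_of_hasGradientAt
    ((hf x).hasGradientAt.sub_half_mul_norm_sq μ) y
  have heq : gradient f x - gradient f y - μ • (x - y) =
      (gradient f x - μ • x) - (gradient f y - μ • y) := by
    rw [smul_sub]; abel
  have hmono : 0 ≤ inner ℝ (gradient f x - gradient f y - μ • (x - y)) (x - y) := by
    have hxy := hlower x y
    have hyx := hlower y x
    rw [← neg_sub x y, inner_neg_right] at hxy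
    rw [heq, inner_sub_left]
    linarith
  refine ⟨hmono, ?_⟩
  rcases hμL.eq_or_lt with rfl | hlt
  · have hsq := pow_le_pow_left₀ (norm_nonneg _) (hlip x y) 2
    rw [inner_sub_left, inner_smul_left, real_inner_self_eq_norm_sq] at hmono
    rw [sub_self, zero_mul, norm_sub_sq_real, inner_smul_right, norm_smul, Real.norm_of_nonneg hμ]
    simp only [conj_trivial] at hmono
    nlinarith [mul_nonneg hμ hmono]
  · rw [heq]
    refine norm_sub_sq_le_mul_inner_of_quadratic_bounds
      (g := fun x => gradient f x - μ • x) (sub_pos.2 hlt) hlower (fun x y => ?_) x y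
    have h := le_add_inner_add_sq_of_lipschitz_gradient hf hlip x y
    have hsq : ‖y‖ ^ 2 = ‖x‖ ^ 2 + 2 * inner ℝ x (y - x) + ‖y - x‖ ^ 2 := by
      rw [← norm_add_sq_real, add_sub_cancel]
    rw [inner_sub_left, inner_smul_left, conj_trivial, hsq]
    linarith

end HilbertSpace

/-- A gradient step with step size `0 < η ≤ 1/L` contracts the distance to the
minimizer by a factor `1 - ημ` for a `μ`-strongly convex function with `L`-Lipschitz gradient. -/
theorem gradient_step_contraction_small_step
    (d : ℕ) (F : EuclideanSpace ℝ (Fin d) → ℝ) (μ L : ℝ)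
    (hμ : 0 < μ) (hμL : μ ≤ L)
    (hdiff : Differentiable ℝ F)
    (hstrong : ConvexOn ℝ Set.univ (fun x => F x - μ / 2 * ‖x‖ ^ 2))
    (hlip : ∀ x y : EuclideanSpace ℝ (Fin d),
      ‖gradient F x - gradient F y‖ ≤ L * ‖x - y‖)
    (xstar : EuclideanSpace ℝ (Fin d)) (hmin : ∀ z, F xstar ≤ F z)
    (η : ℝ) (hη0 : 0 < η) (hη1 : η ≤ 1 / L) :
    ∀ x : EuclideanSpace ℝ (Fin d),
      ‖x - η • gradient F x - xstar‖ ≤ (1 - η * μ) * ‖x - xstar‖ := by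
  intro x
  have hgrad : gradient F xstar = 0 := by
    have hloc : IsLocalMin F xstar := Filter.Eventually.of_forall hmin
    simp [gradient, hloc.fderiv_eq_zero]
  obtain ⟨hmono, hcoc⟩ :=
    norm_sq_le_mul_inner_of_strongly_convex hμ.le hμL hdiff hstrong hlip x xstar
  rw [hgrad, sub_zero] at hmono hcoc
  set e := x - xstar
  set h := gradient F x - μ • e with hh
  have hηL : η * L ≤ 1 := (le_div_iff₀ (hμ.trans_le hμL)).1 hη1
  have hημ : 0 ≤ 1 - η * μ := by nlinarith
  have hstep : x - η • gradient F x - xstar = (1 - η * μ) • e - η • h := by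
    simp only [hh, e]
    module
  refine le_of_sq_le_sq ?_ (by positivity)
  rw [hstep, norm_sub_sq_real, norm_smul, norm_smul, inner_smul_left, inner_smul_right,
    Real.norm_of_nonneg hημ, Real.norm_of_nonneg hη0.le, conj_trivial, real_inner_comm]
  nlinarith [mul_le_mul_of_nonneg_left hcoc (sq_nonneg η),
    mul_nonneg (mul_nonneg hη0.le hmono) (sub_nonneg.2 hηL), mul_nonneg (mul_nonneg hη0.le hmono) hημ]
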